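/- arXiv:1703.01968 — 3 statements merged into one kernel-verified Lean document; each statement's English description precedes it below -/
import Mathlib

section
/- The function g(u) = u·ψ(u)/(2Ψ(u)) − log Ψ(u) is strictly monotonically decreasing on ℝ, i.e., for all real numbers u < v, g(u) > g(v). -/
open Real

/-- The standard normal probability density function. -/
noncomputable def normalPdf (u : ℝ) : ℝ := (Real.sqrt (2 * Real.pi))⁻¹ * Real.exp (-u ^ 2 / 2)

/-- The standard normal cumulative distribution function. -/
noncomputable def normalCdf (u : ℝ) : ℝ := ∫ t in Set.Iic u, normalPdf t

/-- The per-sample MES acquisition value. -/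
noncomputable def mesG (u : ℝ) : ℝ :=
  u * normalPdf u / (2 * normalCdf u) - Real.log (normalCdf u)

theorem aux_pdf_pos (u : ℝ) : 0 < normalPdf u := by
  unfold normalPdf; positivity

theorem aux_pdf_cont : Continuous normalPdf := by
  unfold normalPdf; fun_prop

theorem aux_pdf_int : MeasureTheory.Integrable normalPdf := by
  have h := (integrable_exp_neg_mul_sq (b := 1 / 2) (by norm_num)).const_mul
    (Real.sqrt (2 * Real.pi))⁻¹
  refine h.congr (Filter.Eventually.of_forall fun x => ?_)
  simp only [normalPdf]
  congr 2
  ring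

theorem aux_pdf_le (u : ℝ) : normalPdf u ≤ 1 := by
  unfold normalPdf
  have h1 : (Real.sqrt (2 * Real.pi))⁻¹ ≤ 1 := by
    apply inv_le_one_of_one_le₀
    rw [Real.one_le_sqrt]
    nlinarith [Real.pi_gt_three]
  have h2 : Real.exp (-u ^ 2 / 2) ≤ 1 := by
    rw [Real.exp_le_one_iff]
    nlinarith [sq_nonneg u]
  exact mul_le_one₀ h1 (Real.exp_pos _).le h2

theorem aux_pdf_deriv (u : ℝ) : HasDerivAt normalPdf (-u * normalPdf u) u := by
  have h : HasDerivAt (fun u : ℝ => -u ^ 2 / 2) (-u) u := by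
    have := ((hasDerivAt_pow 2 u).neg).div_const 2
    refine this.congr_deriv ?_
    norm_num
    ring
  have := (h.exp).const_mul (Real.sqrt (2 * Real.pi))⁻¹
  refine HasDerivAt.congr_deriv this ?_
  unfold normalPdf
  ring

theorem aux_cdf_deriv (u : ℝ) : HasDerivAt normalCdf (normalPdf u) u := by
  have e : normalCdf = fun x => normalCdf 0 + ∫ t in (0:ℝ)..x, normalPdf t := by
    funext x
    have := intervalIntegral.integral_Iic_sub_Iic (f := normalPdf) (a := 0) (b := x)
      (μ := MeasureTheory.volume) aux_pdf_int.integrableOn aux_pdf_int.integrableOn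
    unfold normalCdf
    linarith
  rw [e]
  exact (aux_pdf_cont.integral_hasStrictDerivAt 0 u).hasDerivAt.const_add _

theorem aux_cdf_nonneg (u : ℝ) : 0 ≤ normalCdf u :=
  MeasureTheory.integral_nonneg fun x => (aux_pdf_pos x).le

theorem aux_cdf_mono : StrictMono normalCdf :=
  strictMono_of_hasDerivAt_pos aux_cdf_deriv aux_pdf_pos

theorem aux_cdf_pos (u : ℝ) : 0 < normalCdf u :=
  (aux_cdf_nonneg (u - 1)).trans_lt (aux_cdf_mono (by linarith))

theorem aux_F_mono : StrictMono fun u => normalCdf u + u * normalPdf u / (1 + u ^ 2) := by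
  refine strictMono_of_hasDerivAt_pos (f' := fun u => 2 * normalPdf u / (1 + u ^ 2) ^ 2)
    (fun u => ?_) (fun u => ?_)
  · have h1 : (1 + u ^ 2) ≠ 0 := by positivity
    have := (aux_cdf_deriv u).add (((hasDerivAt_id u).mul (aux_pdf_deriv u)).div
      ((hasDerivAt_pow 2 u).const_add 1) h1)
    refine HasDerivAt.congr_deriv this ?_
    simp
    field_simp
    ring
  · have := aux_pdf_pos u
    positivity

theorem aux_F_pos (u : ℝ) : 0 < normalCdf u + u * normalPdf u / (1 + u ^ 2) := by
  refine lt_of_le_of_lt ?_ (aux_F_mono (show u - 1 < u by linarith))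
  refine le_of_tendsto (tendsto_inv_atBot_zero (𝕜 := ℝ)) ?_
  filter_upwards [Filter.eventually_le_atBot (u - 1), Filter.eventually_lt_atBot 0] with x hx hx0
  refine le_trans ?_ (aux_F_mono.monotone hx)
  have h0 := aux_cdf_nonneg x
  have h2 := aux_pdf_le x
  have h3 := aux_pdf_pos x
  have : x⁻¹ ≤ x * normalPdf x / (1 + x ^ 2) := by
    rw [le_div_iff₀ (by positivity)]
    have e : x⁻¹ * (1 + x ^ 2) = x⁻¹ + x := by
      have := hx0.ne
      field_simp
    have := inv_lt_zero.2 hx0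
    rw [e]
    nlinarith
  linarith

/-- `g(u) = u·ψ(u)/(2Ψ(u)) − log Ψ(u)` is strictly monotonically decreasing on `ℝ`. -/
theorem mesG_strictAnti : ∀ u v : ℝ, u < v → mesG u > mesG v := by
  have : StrictAnti mesG := by
    refine strictAnti_of_hasDerivAt_neg (f' := fun u => -(normalPdf u * (1 + u ^ 2) /
      (2 * normalCdf u ^ 2) * (normalCdf u + u * normalPdf u / (1 + u ^ 2))))
      (fun u => ?_) (fun u => ?_)
    · have hc := (aux_cdf_pos u).ne'
      have h1 : (1 + u ^ 2) ≠ 0 := by positivity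
      have := (((hasDerivAt_id u).mul (aux_pdf_deriv u)).div
        ((aux_cdf_deriv u).const_mul 2) (by positivity)).sub ((aux_cdf_deriv u).log hc)
      refine HasDerivAt.congr_deriv this ?_
      simp
      field_simp
      ring
    · have h1 := aux_pdf_pos u
      have h2 := aux_cdf_pos u
      have h3 := aux_F_pos u
      have : 0 < normalPdf u * (1 + u ^ 2) / (2 * normalCdf u ^ 2) := by positivity
      exact neg_neg_of_pos (mul_pos this h3)
  exact fun u v h => this h
end

section
/- Let (Ω, P) be a probability space, let T ≥ 1, and for each t ∈ {1,…,T} let X_t : Ω → ℝ be a random variable whose distribution is Gaussian with mean μ_t and standard deviation σ_t > 0. Pick δ ∈ (0, 1) and positive reals π_1,…,π_T with ∑_{t=1}^T π_t^{-1} ≤ 1 and π_t > 2δ for all t, and set ζ_t = (2·log(π_t/(2δ)))^{1/2}. Then P( for all t ∈ {1,…,T}: μ_t − X_t ≤ ζ_t·σ_t ) ≥ 1 − δ. -/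
open MeasureTheory ProbabilityTheory Real

open scoped NNReal ENNReal

lemma gauss_half (v : ℝ≥0) : gaussianReal 0 v (Set.Ioi 0) ≤ ENNReal.ofReal (1 / 2) := by
  have h1 : gaussianReal 0 v (Set.Ioi 0) = gaussianReal 0 v (Set.Iio 0) := by
    conv_lhs => rw [← neg_zero, ← gaussianReal_map_neg]
    rw [Measure.map_apply measurable_neg measurableSet_Ioi]
    congr 1
    ext x
    simp
  have h2 : gaussianReal 0 v (Set.Ioi 0) + gaussianReal 0 v (Set.Iio 0) ≤ 1 := by
    have hd : Disjoint (Set.Ioi (0 : ℝ)) (Set.Iio 0) :=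
      Set.disjoint_left.mpr fun x hx hy => lt_asymm (Set.mem_Ioi.mp hx) (Set.mem_Iio.mp hy)
    rw [← measure_union hd measurableSet_Iio]
    exact prob_le_one
  rw [← h1] at h2
  have hne : gaussianReal 0 v (Set.Ioi 0) ≠ ∞ := measure_ne_top _ _
  rw [ENNReal.le_ofReal_iff_toReal_le hne (by norm_num)]
  have h3 := ENNReal.toReal_mono ENNReal.one_ne_top h2
  rw [ENNReal.toReal_add hne hne, ENNReal.toReal_one] at h3
  linarith

lemma gauss_tail (v : ℝ≥0) (hv : v ≠ 0) (a : ℝ) (ha : 0 ≤ a) :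
    gaussianReal 0 v (Set.Ioi a) ≤ ENNReal.ofReal (Real.exp (-a ^ 2 / (2 * v)) * (1 / 2)) := by
  have h1 : gaussianReal 0 v (Set.Ioi a) = gaussianReal (-a) v (Set.Ioi 0) := by
    have : gaussianReal 0 v = (gaussianReal (-a) v).map (· + a) := by
      rw [gaussianReal_map_add_const]; simp
    rw [this, Measure.map_apply (measurable_add_const a) measurableSet_Ioi]
    congr 1
    ext x
    simp
  have hv' : (0 : ℝ) < v := by positivity
  rw [h1, gaussianReal_apply _ hv, ENNReal.ofReal_mul (Real.exp_pos _).le]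
  refine le_trans ?_ (mul_le_mul_right (gauss_half v) _)
  rw [gaussianReal_apply _ hv, ← lintegral_const_mul _ (measurable_gaussianPDF 0 v)]
  refine setLIntegral_mono ((measurable_gaussianPDF 0 v).const_mul _) fun x hx => ?_
  have hx : 0 < x := hx
  rw [gaussianPDF, gaussianPDF, ← ENNReal.ofReal_mul (Real.exp_pos _).le]
  apply ENNReal.ofReal_le_ofReal
  rw [gaussianPDFReal, gaussianPDFReal, mul_left_comm, ← Real.exp_add, ← add_div]
  gcongr
  nlinarith [mul_nonneg ha hx.le]

/-- Concentration for marginally Gaussian random variables (Lemma 3.2 of Wang et al. 2016):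
with `ζ_t = (2 log(π_t/(2δ)))^{1/2}`, we have
`P(∀ t, μ_t − X_t ≤ ζ_t σ_t) ≥ 1 − δ`. -/
theorem gaussian_union_concentration
    {Ω : Type*} [MeasurableSpace Ω] (P : Measure Ω) [IsProbabilityMeasure P]
    (T : ℕ) (hT : 1 ≤ T) (μ σ : Fin T → ℝ) (hσ : ∀ t, 0 < σ t)
    (X : Fin T → Ω → ℝ) (hXm : ∀ t, Measurable (X t))
    (hX : ∀ t, Measure.map (X t) P = gaussianReal (μ t) (Real.toNNReal ((σ t) ^ 2)))
    (δ : ℝ) (hδ : δ ∈ Set.Ioo (0 : ℝ) 1)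
    (p : Fin T → ℝ) (hπpos : ∀ t, 0 < p t) (hπδ : ∀ t, 2 * δ < p t)
    (hπsum : ∑ t, (p t)⁻¹ ≤ 1)
    (ζ : Fin T → ℝ) (hζ : ∀ t, ζ t = Real.sqrt (2 * Real.log (p t / (2 * δ)))) :
    ENNReal.ofReal (1 - δ) ≤ P {ω | ∀ t, μ t - X t ω ≤ ζ t * σ t} := by
  have hδ0 := hδ.1
  have key : ∀ t, P {ω | ζ t * σ t < μ t - X t ω} ≤ ENNReal.ofReal (δ * (p t)⁻¹) := by
    intro t
    have hs := hσ t
    have hp := hπpos t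
    have hlaw : P.map (fun ω => μ t - X t ω) = gaussianReal 0 (Real.toNNReal ((σ t) ^ 2)) := by
      have := gaussianReal_map_const_sub (μ := μ t) (v := Real.toNNReal ((σ t) ^ 2)) (μ t)
      rw [← hX t, Measure.map_map (by fun_prop) (hXm t), sub_self] at this
      exact this
    have hz : 0 ≤ ζ t := by rw [hζ]; exact Real.sqrt_nonneg _
    have hle := gauss_tail (Real.toNNReal ((σ t) ^ 2)) (by simp; positivity) (ζ t * σ t)
      (by positivity)
    have hm : Measurable (fun ω => μ t - X t ω) := (hXm t).const_sub _
    rw [← hlaw, Measure.map_apply hm measurableSet_Ioi] at hle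
    refine hle.trans (le_of_eq ?_)
    congr 1
    have h1 : 1 < p t / (2 * δ) := by
      rw [lt_div_iff₀ (by positivity)]; linarith [hπδ t]
    have hlog : 0 ≤ 2 * Real.log (p t / (2 * δ)) := by
      have := Real.log_pos h1
      positivity
    have hz2 : ζ t ^ 2 = 2 * Real.log (p t / (2 * δ)) := by rw [hζ, Real.sq_sqrt hlog]
    rw [Real.coe_toNNReal _ (by positivity)]
    have : -(ζ t * σ t) ^ 2 / (2 * σ t ^ 2) = -Real.log (p t / (2 * δ)) := by
      rw [mul_pow, hz2]; field_simp
    rw [this, Real.exp_neg, Real.exp_log (by linarith)]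
    field_simp
  have hms : MeasurableSet {ω | ∀ t, μ t - X t ω ≤ ζ t * σ t} := by
    rw [Set.ofPred_forall]
    exact MeasurableSet.iInter fun t =>
      measurableSet_le ((hXm t).const_sub _) measurable_const
  have hc : P {ω | ∀ t, μ t - X t ω ≤ ζ t * σ t}ᶜ ≤ ENNReal.ofReal δ := by
    have : {ω | ∀ t, μ t - X t ω ≤ ζ t * σ t}ᶜ = ⋃ t, {ω | ζ t * σ t < μ t - X t ω} := by
      ext ω; simp [lt_sub_iff_add_lt]
    rw [this]
    refine (measure_iUnion_fintype_le _ _).trans ((Finset.sum_le_sum fun t _ => key t).trans ?_)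
    rw [← ENNReal.ofReal_sum_of_nonneg fun t _ => by have := hπpos t; positivity,
      ← Finset.mul_sum]
    exact ENNReal.ofReal_le_ofReal (by nlinarith)
  rw [ENNReal.ofReal_sub _ hδ0.le, ENNReal.ofReal_one, tsub_le_iff_right,
    ← prob_add_prob_compl (μ := P) hms]
  gcongr
end

section
/- (Slepian's comparison lemma) Let n ≥ 1 and let u, v be ℝⁿ-valued centered multivariate Gaussian random vectors with covariance matrices Σᵘ and Σᵛ (both positive semidefinite) such that Σᵘ_{ii} = Σᵛ_{ii} for all i (equal variances) and Σᵛ_{ij} ≤ Σᵘ_{ij} for all i, j. Then for every y ∈ ℝ, P( max_{1 ≤ i ≤ n} v_i ≤ y ) ≤ P( max_{1 ≤ i ≤ n} u_i ≤ y ). -/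
open MeasureTheory ProbabilityTheory Matrix

/-- `u` is an `ℝⁿ`-valued centered Gaussian random vector with covariance matrix `S`:
every linear functional of `u` is Gaussian with mean `0` and variance the
corresponding quadratic form of `S`. -/
def IsCenteredGaussianVector {Ω : Type*} [MeasurableSpace Ω] (P : Measure Ω)
    {n : ℕ} (u : Ω → Fin n → ℝ) (S : Matrix (Fin n) (Fin n) ℝ) : Prop :=
  ∀ a : Fin n → ℝ,
    Measure.map (fun ω => ∑ i, a i * u ω i) P
      = gaussianReal 0 (Real.toNNReal (a ⬝ᵥ S.mulVec a))

lemma slep_ibp1 (h h' : ℝ → ℝ) (C : ℝ) (hd : ∀ x, HasDerivAt h (h' x) x) (hc : Continuous h')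
    (hb : ∀ x, |h x| ≤ C) (hb' : ∀ x, |h' x| ≤ C) :
    ∫ s, s * h s ∂(gaussianReal 0 1) = ∫ s, h' s ∂(gaussianReal 0 1) := by
  have hcont : Continuous h := continuous_iff_continuousAt.2 fun x => (hd x).continuousAt
  rw [integral_gaussianReal_eq_integral_smul one_ne_zero,
    integral_gaussianReal_eq_integral_smul one_ne_zero]
  simp only [smul_eq_mul]
  set p := gaussianPDFReal 0 1 with hp
  have hpe : p = fun x => (√(2 * Real.pi))⁻¹ * Real.exp (-(1/2) * x ^ 2) := by
    ext x; simp [hp, gaussianPDFReal]; left; ring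
  have hpd : ∀ x, HasDerivAt p (-x * p x) x := by
    intro x
    rw [hpe]
    have := (((hasDerivAt_pow 2 x).const_mul (-(1/2):ℝ)).exp).const_mul (√(2 * Real.pi))⁻¹
    refine this.congr_deriv ?_
    simp; ring
  have hpi : Integrable p := integrable_gaussianPDFReal 0 1
  have hxp : Integrable (fun x => x * p x) := by
    rw [hpe]
    have := (integrable_mul_exp_neg_mul_sq (b := 1/2) (by norm_num)).const_mul (√(2 * Real.pi))⁻¹
    refine this.congr (ae_of_all _ fun x => ?_)
    simp; ring
  have h1 : Integrable (fun x => h x * (x * p x)) :=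
    hxp.bdd_mul hcont.aestronglyMeasurable (ae_of_all _ hb)
  have h2 : Integrable (fun x => h' x * p x) :=
    hpi.bdd_mul hc.aestronglyMeasurable (ae_of_all _ hb')
  have h3 : Integrable (fun x => h x * p x) :=
    hpi.bdd_mul hcont.aestronglyMeasurable (ae_of_all _ hb)
  have key := integral_mul_deriv_eq_deriv_mul_of_integrable (u := h) (v := p) (u' := h')
    (v' := fun x => -x * p x) (fun x _ => hd x) (fun x _ => hpd x)
    (by refine h1.neg.congr (ae_of_all _ fun x => ?_); simp)
    h2 h3
  have e1 : ∫ x, p x * (x * h x) = - ∫ x, h x * (-x * p x) := by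
    rw [← integral_neg]; congr 1; ext x; ring
  rw [e1, key, neg_neg]; congr 1; ext x; ring

lemma slep_upd {ι : Type*} [Fintype ι] [DecidableEq ι] (γ : Measure ℝ) [IsProbabilityMeasure γ] (k : ι) :
    MeasurePreserving (fun q : (ι → ℝ) × ℝ => Function.update q.1 k q.2)
      ((Measure.pi fun _ : ι => γ).prod γ) (Measure.pi fun _ : ι => γ) := by
  have hm : Measurable (fun q : (ι → ℝ) × ℝ => Function.update q.1 k q.2) := by
    rw [measurable_pi_iff]; intro i
    by_cases h : i = k
    · subst h; simpa using measurable_snd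
    · simp only [Function.update_of_ne h]; fun_prop
  refine ⟨hm, ?_⟩
  symm
  apply Measure.pi_eq
  intro s hs
  rw [Measure.map_apply hm (MeasurableSet.univ_pi hs)]
  have : (fun q : (ι → ℝ) × ℝ => Function.update q.1 k q.2) ⁻¹' (Set.univ.pi s)
      = (Set.univ.pi (Function.update s k Set.univ)) ×ˢ (s k) := by
    ext ⟨x, t⟩
    simp only [Set.mem_preimage, Set.mem_pi, Set.mem_univ, true_implies, Set.mem_prod]
    constructor
    · intro h
      refine ⟨fun i => ?_, by simpa using h k⟩
      by_cases hi : i = k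
      · subst hi; simp
      · simpa [hi] using h i
    · rintro ⟨h, ht⟩ i
      by_cases hi : i = k
      · subst hi; simpa using ht
      · simpa [hi] using h i
  rw [this, Measure.prod_prod, Measure.pi_pi]
  rw [← Finset.mul_prod_erase _ _ (Finset.mem_univ k), ← Finset.mul_prod_erase _ (fun i => γ (s i)) (Finset.mem_univ k)]
  simp only [Function.update_self, measure_univ, one_mul]
  rw [mul_comm]; congr 1
  refine Finset.prod_congr rfl fun i hi => ?_
  rw [Function.update_of_ne (Finset.ne_of_mem_erase hi)]

lemma slep_coord_int {ι : Type*} [Fintype ι] (k : ι) :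
    Integrable (fun g : ι → ℝ => g k) (Measure.pi fun _ : ι => gaussianReal 0 1) := by
  have := (memLp_id_gaussianReal (μ := 0) (v := 1) 1)
  exact integrable_eval (memLp_one_iff_integrable.1 (by simpa using this))

lemma slep_ibp {ι : Type*} [Fintype ι] [DecidableEq ι] (k : ι) (h h' : (ι → ℝ) → ℝ) (C : ℝ)
    (hd : ∀ g s, HasDerivAt (fun s => h (Function.update g k s)) (h' (Function.update g k s)) s)
    (hcont : Continuous h) (hc : Continuous h')
    (hb : ∀ x, |h x| ≤ C) (hb' : ∀ x, |h' x| ≤ C) :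
    ∫ g, g k * h g ∂(Measure.pi fun _ : ι => gaussianReal 0 1)
      = ∫ g, h' g ∂(Measure.pi fun _ : ι => gaussianReal 0 1) := by
  have mp := slep_upd (gaussianReal 0 1) k
  have i1 : Integrable (fun g => g k * h g) (Measure.pi fun _ : ι => gaussianReal 0 1) :=
    (slep_coord_int k).mul_bdd hcont.aestronglyMeasurable (ae_of_all _ hb)
  have i2 : Integrable h' (Measure.pi fun _ : ι => gaussianReal 0 1) :=
    Integrable.of_bound hc.aestronglyMeasurable C (ae_of_all _ hb')
  rw [← mp.map_eq] at i1 i2 ⊢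
  rw [integral_map mp.measurable.aemeasurable i1.1, integral_map mp.measurable.aemeasurable i2.1,
    integral_prod (fun q : (ι → ℝ) × ℝ => Function.update q.1 k q.2 k * h (Function.update q.1 k q.2))
      ((integrable_map_measure i1.1 mp.measurable.aemeasurable).1 i1),
    integral_prod (fun q : (ι → ℝ) × ℝ => h' (Function.update q.1 k q.2))
      ((integrable_map_measure i2.1 mp.measurable.aemeasurable).1 i2)]
  congr 1; ext x
  simp only [Function.update_self]
  exact slep_ibp1 _ _ C (hd x) (hc.comp (by fun_prop)) (fun _ => hb _) (fun _ => hb' _)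

lemma slep_law {Ω : Type*} [MeasurableSpace Ω] (P : Measure Ω) [IsProbabilityMeasure P]
    {n : ℕ} {ι : Type*} [Fintype ι] (u : Ω → Fin n → ℝ) (hum : Measurable u)
    (S : Matrix (Fin n) (Fin n) ℝ)
    (hu : ∀ a : Fin n → ℝ, Measure.map (fun ω => ∑ i, a i * u ω i) P
      = gaussianReal 0 (Real.toNNReal (a ⬝ᵥ S.mulVec a)))
    (a : Fin n → ι → ℝ) (ha : ∀ i j, ∑ k, a i k * a j k = S i j) :
    P.map u = (Measure.pi fun _ : ι => gaussianReal 0 1).map (fun g i => ∑ k, a i k * g k) := by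
  have hX : Measurable (fun (g : ι → ℝ) (i : Fin n) => ∑ k, a i k * g k) := by fun_prop
  have := Measure.isProbabilityMeasure_map (μ := P) hum.aemeasurable
  have := Measure.isProbabilityMeasure_map (μ := (Measure.pi fun _ : ι => gaussianReal 0 1)) hX.aemeasurable
  apply Measure.ext_of_charFunDual
  ext L
  set l : Fin n → ℝ := fun i => L (Pi.single i 1) with hl
  have hL : ∀ x, L x = ∑ i, l i * x i := by
    intro x
    conv_lhs => rw [pi_eq_sum_univ' x, map_sum]
    refine Finset.sum_congr rfl fun i _ => ?_
    rw [map_smul, smul_eq_mul, mul_comm]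
  have hq : l ⬝ᵥ S.mulVec l = ∑ k, (∑ i, l i * a i k) ^ 2 := by
    simp only [dotProduct, mulVec, ← ha, sq, Finset.sum_mul_sum, Finset.sum_mul, Finset.mul_sum]
    rw [Finset.sum_comm' (t' := Finset.univ) (s' := fun _ => Finset.univ) (by simp)]
    simp_rw [Finset.sum_comm (s := (Finset.univ : Finset ι))]
    rw [Finset.sum_comm]
    refine Finset.sum_congr rfl fun i _ => Finset.sum_congr rfl fun j _ => Finset.sum_congr rfl fun k _ => by ring
  rw [charFunDual_eq_charFun_map_one, Measure.map_map (by fun_prop) hum]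
  have : (L ∘ u) = fun ω => ∑ i, l i * u ω i := by ext ω; exact hL _
  rw [this, hu, charFun_gaussianReal, charFunDual_apply, integral_map hX.aemeasurable (by fun_prop)]
  have h2 : ∀ g : ι → ℝ, Complex.exp (L (fun i => ∑ k, a i k * g k) * Complex.I)
      = ∏ k, Complex.exp (((∑ i, l i * a i k : ℝ) : ℂ) * (g k : ℂ) * Complex.I) := by
    intro g
    rw [← Complex.exp_sum, ← Finset.sum_mul, hL]
    congr 2
    push_cast
    simp_rw [Finset.mul_sum, Finset.sum_mul]
    rw [Finset.sum_comm]
    refine Finset.sum_congr rfl fun i _ => Finset.sum_congr rfl fun j _ => by ring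
  simp_rw [h2]
  rw [integral_fintype_prod_eq_prod (f := fun k (x:ℝ) => Complex.exp (((∑ i, l i * a i k : ℝ) : ℂ) * (x : ℂ) * Complex.I))]
  simp_rw [← charFun_apply_real, charFun_gaussianReal, ← Complex.exp_sum]
  have hnn : 0 ≤ l ⬝ᵥ S.mulVec l := by rw [hq]; positivity
  rw [Real.coe_toNNReal _ hnn, hq]
  congr 1
  push_cast
  simp [Finset.sum_div]

lemma slep_interp {n : ℕ} {ι : Type*} [Fintype ι] [DecidableEq ι]
    (F : (Fin n → ℝ) → ℝ) (G : Fin n → (Fin n → ℝ) → ℝ) (H : Fin n → Fin n → (Fin n → ℝ) → ℝ)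
    (C : ℝ) (hFc : Continuous F) (hGc : ∀ i, Continuous (G i)) (hHc : ∀ i j, Continuous (H i j))
    (hFb : ∀ x, |F x| ≤ C) (hGb : ∀ i x, |G i x| ≤ C) (hHb : ∀ i j x, |H i j x| ≤ C)
    (hF : ∀ (c : ℝ → Fin n → ℝ) (c' : Fin n → ℝ) (t : ℝ), (∀ i, HasDerivAt (fun s => c s i) (c' i) t) →
      HasDerivAt (fun s => F (c s)) (∑ i, G i (c t) * c' i) t)
    (hG : ∀ (i : Fin n) (c : ℝ → Fin n → ℝ) (c' : Fin n → ℝ) (t : ℝ),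
      (∀ i, HasDerivAt (fun s => c s i) (c' i) t) →
      HasDerivAt (fun s => G i (c s)) (∑ j, H i j (c t) * c' j) t)
    (hHpos : ∀ i j, i ≠ j → ∀ x, 0 ≤ H i j x)
    (Su Sv : Matrix (Fin n) (Fin n) ℝ)
    (hdiag : ∀ i, Su i i = Sv i i) (hle : ∀ i j, Sv i j ≤ Su i j)
    (a b : Fin n → ι → ℝ) (ha : ∀ i j, ∑ k, a i k * a j k = Su i j)
    (hb : ∀ i j, ∑ k, b i k * b j k = Sv i j) (hab : ∀ i j, ∑ k, a i k * b j k = 0) :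
    ∫ g, F (fun i => ∑ k, b i k * g k) ∂(Measure.pi fun _ : ι => gaussianReal 0 1)
     ≤ ∫ g, F (fun i => ∑ k, a i k * g k) ∂(Measure.pi fun _ : ι => gaussianReal 0 1) := by
  set γ := (Measure.pi fun _ : ι => gaussianReal 0 1) with hγ
  set m : ℝ → Fin n → ι → ℝ := fun θ i k => Real.sin θ * a i k + Real.cos θ * b i k with hm
  set m' : ℝ → Fin n → ι → ℝ := fun θ i k => Real.cos θ * a i k - Real.sin θ * b i k with hm'
  set X : ℝ → (ι → ℝ) → Fin n → ℝ := fun θ g i => ∑ k, m θ i k * g k with hX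
  have hXc : ∀ θ, Continuous (X θ) := fun θ => by simp only [hX]; fun_prop
  have hmd : ∀ θ i k, HasDerivAt (fun θ => m θ i k) (m' θ i k) θ := by
    intro θ i k
    have := ((Real.hasDerivAt_sin θ).mul_const (a i k)).add ((Real.hasDerivAt_cos θ).mul_const (b i k))
    refine this.congr_deriv ?_
    simp only [hm']; ring
  have hXd : ∀ g θ i, HasDerivAt (fun θ => X θ g i) (∑ k, m' θ i k * g k) θ := by
    intro g θ i
    exact HasDerivAt.fun_sum fun k _ => (hmd θ i k).mul_const (g k)
  have hm'b : ∀ θ i k, |m' θ i k| ≤ |a i k| + |b i k| := by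
    intro θ i k
    simp only [hm']
    refine (abs_sub _ _).trans ?_
    rw [abs_mul, abs_mul]
    have h1 := Real.abs_cos_le_one θ
    have h2 := Real.abs_sin_le_one θ
    have h3 := abs_nonneg (a i k)
    have h4 := abs_nonneg (b i k)
    nlinarith
  have hder : ∀ θ, HasDerivAt (fun θ => ∫ g, F (X θ g) ∂γ)
      (∫ g, ∑ i, G i (X θ g) * ∑ k, m' θ i k * g k ∂γ) θ := by
    intro θ
    refine (hasDerivAt_integral_of_dominated_loc_of_deriv_le (F := fun θ g => F (X θ g))
      (F' := fun θ g => ∑ i, G i (X θ g) * ∑ k, m' θ i k * g k)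
      (bound := fun g => ∑ i, C * ∑ k, (|a i k| + |b i k|) * |g k|)
      (s := Set.univ) Filter.univ_mem
      (Filter.Eventually.of_forall fun θ => (hFc.comp (hXc θ)).aestronglyMeasurable)
      (Integrable.of_bound (hFc.comp (hXc θ)).aestronglyMeasurable C (ae_of_all _ fun x => hFb _))
      ?_ ?_ ?_ ?_).2
    · refine Continuous.aestronglyMeasurable ?_
      refine continuous_finsetSum _ fun i _ => ((hGc i).comp (hXc θ)).mul (by fun_prop)
    · refine ae_of_all _ fun g t _ => ?_
      refine (norm_sum_le _ _).trans (Finset.sum_le_sum fun i _ => ?_)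
      rw [norm_mul]
      refine mul_le_mul (hGb i _) ?_ (norm_nonneg _) ((abs_nonneg _).trans (hGb i (X t g)))
      refine (norm_sum_le _ _).trans (Finset.sum_le_sum fun k _ => ?_)
      rw [norm_mul]
      exact mul_le_mul_of_nonneg_right (hm'b t i k) (norm_nonneg _)
    · refine integrable_finsetSum _ fun i _ => Integrable.const_mul (integrable_finsetSum _ fun k _ => ?_) _
      exact ((slep_coord_int k).abs).const_mul _
    · exact ae_of_all _ fun g t _ => hF (fun t => X t g) _ t (hXd g t)
  have hval : ∀ θ, (∫ g, ∑ i, G i (X θ g) * ∑ k, m' θ i k * g k ∂γ)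
      = ∑ i, ∑ j, (Real.sin θ * Real.cos θ * (Su i j - Sv i j)) * ∫ g, H i j (X θ g) ∂γ := by
    intro θ
    have hI : ∀ i k, Integrable (fun g => g k * G i (X θ g)) γ := fun i k =>
      (slep_coord_int k).mul_bdd ((hGc i).comp (hXc θ)).aestronglyMeasurable (ae_of_all _ fun g => hGb i _)
    have hJ : ∀ i j, Integrable (fun g => H i j (X θ g)) γ := fun i j =>
      Integrable.of_bound ((hHc i j).comp (hXc θ)).aestronglyMeasurable C (ae_of_all _ fun x => hHb i j _)
    have e1 : ∀ g, ∑ i, G i (X θ g) * ∑ k, m' θ i k * g k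
        = ∑ i, ∑ k, m' θ i k * (g k * G i (X θ g)) := by
      intro g
      simp_rw [Finset.mul_sum]
      refine Finset.sum_congr rfl fun i _ => Finset.sum_congr rfl fun k _ => by ring
    simp_rw [e1]
    rw [integral_finsetSum _ fun i _ => integrable_finsetSum _ fun k _ => (hI i k).const_mul _]
    refine Finset.sum_congr rfl fun i _ => ?_
    rw [integral_finsetSum _ fun k _ => (hI i k).const_mul _]
    simp_rw [integral_const_mul]
    have e2 : ∀ k, ∫ g, g k * G i (X θ g) ∂γ = ∑ j, m θ j k * ∫ g, H i j (X θ g) ∂γ := by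
      intro k
      rw [slep_ibp k (fun g => G i (X θ g)) (fun g => ∑ j, H i j (X θ g) * m θ j k)
        (C + ∑ j, C * |m θ j k|) ?_ ((hGc i).comp (hXc θ))
        (continuous_finsetSum _ fun j _ => ((hHc i j).comp (hXc θ)).mul continuous_const) ?_ ?_]
      · rw [integral_finsetSum _ fun j _ => (hJ i j).mul_const _]
        refine Finset.sum_congr rfl fun j _ => ?_
        rw [integral_mul_const, mul_comm]
      · intro g s
        refine hG i (fun s => X θ (Function.update g k s)) (fun j => m θ j k) s fun j => ?_
        simp only [hX]
        have : ∀ l ∈ Finset.univ, HasDerivAt (fun s => m θ j l * Function.update g k s l)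
            (if l = k then m θ j l else 0) s := by
          intro l _
          by_cases hl : l = k
          · subst hl
            simpa using (hasDerivAt_id s).const_mul (m θ j l)
          · simpa [hl] using hasDerivAt_const s (m θ j l * g l)
        simpa using HasDerivAt.fun_sum this
      · intro g
        have hC : 0 ≤ C := (abs_nonneg _).trans (hGb i (X θ g))
        exact (hGb i _).trans (le_add_of_nonneg_right (by positivity))
      · intro g
        have hC : 0 ≤ C := (abs_nonneg _).trans (hGb i (X θ g))
        refine le_trans ?_ (le_add_of_nonneg_left hC)
        refine (Finset.abs_sum_le_sum_abs _ _).trans (Finset.sum_le_sum fun j _ => ?_)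
        rw [abs_mul]
        exact mul_le_mul_of_nonneg_right (hHb i j _) (abs_nonneg _)
    simp_rw [e2, Finset.mul_sum]
    rw [Finset.sum_comm]
    refine Finset.sum_congr rfl fun j _ => ?_
    simp_rw [← mul_assoc]
    rw [← Finset.sum_mul]
    congr 1
    have e3 : ∀ k, m' θ i k * m θ j k = Real.sin θ * Real.cos θ * (a i k * a j k)
        - Real.sin θ * Real.cos θ * (b i k * b j k) + Real.cos θ ^ 2 * (a i k * b j k)
        - Real.sin θ ^ 2 * (a j k * b i k) := by
      intro k; simp only [hm, hm']; ring
    simp_rw [e3]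
    rw [Finset.sum_sub_distrib, Finset.sum_add_distrib, Finset.sum_sub_distrib]
    simp_rw [← Finset.mul_sum]
    rw [ha, hb, hab, hab]; ring
  have hmono : MonotoneOn (fun θ => ∫ g, F (X θ g) ∂γ) (Set.Icc 0 (Real.pi / 2)) := by
    refine monotoneOn_of_deriv_nonneg (convex_Icc _ _)
      (fun θ _ => (hder θ).continuousAt.continuousWithinAt)
      (fun θ _ => (hder θ).differentiableAt.differentiableWithinAt) ?_
    intro θ hθ
    rw [interior_Icc] at hθ
    rw [(hder θ).deriv, hval]
    refine Finset.sum_nonneg fun i _ => Finset.sum_nonneg fun j _ => ?_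
    by_cases hij : i = j
    · subst hij; simp [hdiag]
    · have hs := Real.sin_nonneg_of_nonneg_of_le_pi hθ.1.le (by linarith [hθ.2, Real.pi_pos])
      have hc := Real.cos_nonneg_of_neg_pi_div_two_le_of_le (by linarith [hθ.1, Real.pi_pos]) hθ.2.le
      refine mul_nonneg (mul_nonneg (mul_nonneg hs hc) (sub_nonneg.2 (hle i j)))
        (integral_nonneg fun g => hHpos i j hij _)
  have := hmono (Set.left_mem_Icc.2 (by positivity)) (Set.right_mem_Icc.2 (by positivity))
    (by positivity)
  simpa [hX, hm] using this

lemma slep_prod {n : ℕ} {ι : Type*} [Fintype ι] [DecidableEq ι]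
    (φ φ' φ'' : ℝ → ℝ) (K : ℝ) (hd : ∀ x, HasDerivAt φ (φ' x) x) (hd' : ∀ x, HasDerivAt φ' (φ'' x) x)
    (hc : Continuous φ'') (h0 : ∀ x, 0 ≤ φ x) (h1 : ∀ x, φ x ≤ 1) (hn : ∀ x, φ' x ≤ 0)
    (hb' : ∀ x, |φ' x| ≤ K) (hb'' : ∀ x, |φ'' x| ≤ K)
    (Su Sv : Matrix (Fin n) (Fin n) ℝ)
    (hdiag : ∀ i, Su i i = Sv i i) (hle : ∀ i j, Sv i j ≤ Su i j)
    (a b : Fin n → ι → ℝ) (ha : ∀ i j, ∑ k, a i k * a j k = Su i j)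
    (hb : ∀ i j, ∑ k, b i k * b j k = Sv i j) (hab : ∀ i j, ∑ k, a i k * b j k = 0) :
    ∫ g, ∏ i, φ (∑ k, b i k * g k) ∂(Measure.pi fun _ : ι => gaussianReal 0 1)
     ≤ ∫ g, ∏ i, φ (∑ k, a i k * g k) ∂(Measure.pi fun _ : ι => gaussianReal 0 1) := by
  have c0 : Continuous φ := continuous_iff_continuousAt.2 fun x => (hd x).continuousAt
  have c1 : Continuous φ' := continuous_iff_continuousAt.2 fun x => (hd' x).continuousAt
  have hK : 0 ≤ K := (abs_nonneg _).trans (hb' 0)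
  have hp : ∀ (s : Finset (Fin n)) (x : Fin n → ℝ), 0 ≤ ∏ l ∈ s, φ (x l) :=
    fun s x => Finset.prod_nonneg fun i _ => h0 _
  have hp1 : ∀ (s : Finset (Fin n)) (x : Fin n → ℝ), |∏ l ∈ s, φ (x l)| ≤ 1 := fun s x => by
    rw [abs_of_nonneg (hp s x)]
    exact Finset.prod_le_one (fun i _ => h0 _) (fun i _ => h1 _)
  refine slep_interp (F := fun x => ∏ i, φ (x i))
    (G := fun i x => φ' (x i) * ∏ l ∈ Finset.univ.erase i, φ (x l))
    (H := fun i j x => if j = i then φ'' (x i) * ∏ l ∈ Finset.univ.erase i, φ (x l)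
      else φ' (x i) * (φ' (x j) * ∏ l ∈ (Finset.univ.erase i).erase j, φ (x l)))
    (C := 1 + K + K * K) ?_ ?_ ?_ ?_ ?_ ?_ ?_ ?_ ?_ Su Sv hdiag hle a b ha hb hab
  · fun_prop
  · intro i; fun_prop
  · intro i j
    split_ifs <;> fun_prop
  · intro x
    refine (hp1 _ x).trans ?_
    nlinarith
  · intro i x
    rw [abs_mul]
    have := mul_le_mul (hb' (x i)) (hp1 (Finset.univ.erase i) x) (abs_nonneg _) hK
    nlinarith
  · intro i j x
    try dsimp only
    split_ifs
    · rw [abs_mul]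
      have := mul_le_mul (hb'' (x i)) (hp1 (Finset.univ.erase i) x) (abs_nonneg _) hK
      nlinarith
    · rw [abs_mul, abs_mul]
      have := mul_le_mul (hb' (x j)) (hp1 ((Finset.univ.erase i).erase j) x) (abs_nonneg _) hK
      have := mul_le_mul (hb' (x i)) this (by positivity) hK
      nlinarith
  · intro c c' t h
    have := HasDerivAt.fun_finsetProd (u := Finset.univ) fun i _ => (hd (c t i)).comp t (h i)
    refine this.congr_deriv ?_
    refine Finset.sum_congr rfl fun i _ => ?_
    simp only [Function.comp, smul_eq_mul]; ring
  · intro i c c' t h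
    have h2 := HasDerivAt.fun_finsetProd (u := Finset.univ.erase i) fun i _ => (hd (c t i)).comp t (h i)
    have := ((hd' (c t i)).comp t (h i)).mul h2
    refine this.congr_deriv ?_
    rw [← Finset.add_sum_erase _ _ (Finset.mem_univ i)]
    simp only [if_true, Function.comp, smul_eq_mul, Finset.mul_sum]
    congr 1
    · ring
    · refine Finset.sum_congr rfl fun j hj => ?_
      rw [if_neg (Finset.ne_of_mem_erase hj)]; ring
  · intro i j hij x
    try dsimp only
    rw [if_neg (Ne.symm hij), ← mul_assoc]
    exact mul_nonneg (mul_nonneg_of_nonpos_of_nonpos (hn _) (hn _)) (hp _ _)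

lemma slep_sig {n : ℕ} {ι : Type*} [Fintype ι] [DecidableEq ι] (y : ℝ) (p q : ℝ) (hp : 0 ≤ p)
    (Su Sv : Matrix (Fin n) (Fin n) ℝ)
    (hdiag : ∀ i, Su i i = Sv i i) (hle : ∀ i j, Sv i j ≤ Su i j)
    (a b : Fin n → ι → ℝ) (ha : ∀ i j, ∑ k, a i k * a j k = Su i j)
    (hb : ∀ i j, ∑ k, b i k * b j k = Sv i j) (hab : ∀ i j, ∑ k, a i k * b j k = 0) :
    ∫ g, ∏ i, Real.sigmoid (p * (y - ∑ k, b i k * g k) + q) ∂(Measure.pi fun _ : ι => gaussianReal 0 1)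
     ≤ ∫ g, ∏ i, Real.sigmoid (p * (y - ∑ k, a i k * g k) + q) ∂(Measure.pi fun _ : ι => gaussianReal 0 1) := by
  have hl : ∀ x, HasDerivAt (fun x => p * (y - x) + q) (-p) x := fun x => by
    simpa using (((hasDerivAt_id x).const_sub y).const_mul p).add_const q
  have hs : ∀ x, HasDerivAt (fun x => Real.sigmoid (p * (y - x) + q))
    (Real.sigmoid (p * (y - x) + q) * (1 - Real.sigmoid (p * (y - x) + q)) * (-p)) x :=
    fun x => (Real.hasDerivAt_sigmoid _).comp x (hl x)
  have cs : Continuous (fun x => Real.sigmoid (p * (y - x) + q)) :=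
    continuous_iff_continuousAt.2 fun x => (hs x).continuousAt
  refine slep_prod (φ := fun x => Real.sigmoid (p * (y - x) + q)) _
    (fun x => (Real.sigmoid (p * (y - x) + q) * (1 - Real.sigmoid (p * (y - x) + q)) * (-p)) * (1 - 2 * Real.sigmoid (p * (y - x) + q)) * (-p))
    (p + p * p) hs ?_ (by fun_prop) (fun x => Real.sigmoid_nonneg _) (fun x => Real.sigmoid_le_one _) ?_ ?_ ?_ Su Sv hdiag hle a b ha hb hab
  · intro x
    refine (((hs x).mul ((hs x).const_sub 1)).mul_const (-p)).congr_deriv ?_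
    ring
  all_goals
    intro x
    try dsimp only
    have s0 := Real.sigmoid_nonneg (p * (y - x) + q)
    have s1 := Real.sigmoid_le_one (p * (y - x) + q)
    set s := Real.sigmoid (p * (y - x) + q)
    have t0 : 0 ≤ s * (1 - s) := mul_nonneg s0 (by linarith)
    have t1 : s * (1 - s) ≤ 1 := by nlinarith
  · nlinarith
  · rw [abs_mul, abs_of_nonneg t0, abs_neg, abs_of_nonneg hp]
    nlinarith
  · have : |1 - 2 * s| ≤ 1 := abs_le.2 ⟨by linarith, by linarith⟩
    rw [abs_mul, abs_mul, abs_mul, abs_of_nonneg t0, abs_neg, abs_of_nonneg hp]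
    have h3 : s * (1 - s) * p ≤ p := by nlinarith
    have h4 : s * (1 - s) * p * |1 - 2 * s| ≤ p := by
      calc _ ≤ p * 1 := mul_le_mul h3 this (abs_nonneg _) hp
        _ = p := mul_one p
    nlinarith

lemma slep_lim {n : ℕ} (μ : Measure (Fin n → ℝ)) [IsProbabilityMeasure μ] (y : ℝ) :
    Filter.Tendsto (fun N : ℕ => ∫ x, ∏ i, Real.sigmoid ((N : ℝ) ^ 2 * (y - x i) + N) ∂μ)
      Filter.atTop (nhds (μ.real {x | ∀ i, x i ≤ y})) := by
  have hms : MeasurableSet {x : Fin n → ℝ | ∀ i, x i ≤ y} := by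
    rw [Set.ofPred_forall]
    exact MeasurableSet.iInter fun i => measurableSet_le (measurable_pi_apply i) measurable_const
  rw [← integral_indicator_one hms]
  refine tendsto_integral_of_dominated_convergence (fun _ => 1) ?_ (integrable_const _) ?_ ?_
  · intro N
    refine Continuous.aestronglyMeasurable ?_
    exact continuous_finsetProd _ fun i _ => continuous_sigmoid.comp (by fun_prop)
  · intro N
    refine ae_of_all _ fun x => ?_
    rw [Real.norm_eq_abs, abs_of_nonneg (Finset.prod_nonneg fun i _ => Real.sigmoid_nonneg _)]
    exact Finset.prod_le_one (fun i _ => Real.sigmoid_nonneg _) (fun i _ => Real.sigmoid_le_one _)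
  · refine ae_of_all _ fun x => ?_
    have hN : Filter.Tendsto (fun N : ℕ => (N : ℝ)) Filter.atTop Filter.atTop := tendsto_natCast_atTop_atTop
    have e : Set.indicator {x : Fin n → ℝ | ∀ i, x i ≤ y} (1 : (Fin n → ℝ) → ℝ) x = ∏ i, (if x i ≤ y then (1:ℝ) else 0) := by
      by_cases h : ∀ i, x i ≤ y
      · rw [Set.indicator_of_mem (by exact h)]; simp [h]
      · rw [Set.indicator_of_notMem (by exact h)]
        push Not at h
        obtain ⟨i, hi⟩ := h
        exact (Finset.prod_eq_zero (Finset.mem_univ i) (by simp [hi])).symm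
    rw [e]
    refine tendsto_finsetProd _ fun i _ => ?_
    split_ifs with h
    · refine Real.tendsto_sigmoid_atTop.comp ?_
      refine Filter.tendsto_atTop_mono (fun N => ?_) hN
      have := mul_nonneg (sq_nonneg (N : ℝ)) (sub_nonneg.2 h)
      linarith
    · refine Real.tendsto_sigmoid_atBot.comp ?_
      push Not at h
      have h1 : Filter.Tendsto (fun N : ℕ => (N : ℝ) * ((N:ℝ) * (y - x i) + 1)) Filter.atTop Filter.atBot := by
        refine hN.atTop_mul_atBot₀ ?_
        exact Filter.tendsto_atBot_add_const_right _ _ (hN.atTop_mul_const_of_neg (sub_neg.2 h))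
      refine h1.congr fun N => by ring

open scoped MatrixOrder in
lemma slep_fac {n : ℕ} {S : Matrix (Fin n) (Fin n) ℝ} (h : S.PosSemidef) :
    ∃ A : Matrix (Fin n) (Fin n) ℝ, S = Aᴴ * A := by
  refine ⟨CFC.sqrt S, ?_⟩
  have h1 := CFC.sqrt_mul_sqrt_self S h.nonneg
  have h2 : (CFC.sqrt S)ᴴ = CFC.sqrt S := (CFC.sqrt_nonneg S).isSelfAdjoint
  rw [h2, h1]

/-- Slepian's comparison lemma: if two centered Gaussian vectors have the same variances
and `E[v_i v_j] ≤ E[u_i u_j]` entrywise, then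
`P(max_i v_i ≤ y) ≤ P(max_i u_i ≤ y)` for every `y`. -/
theorem slepian_comparison
    {Ω : Type*} [MeasurableSpace Ω] (P : Measure Ω) [IsProbabilityMeasure P]
    (n : ℕ) (hn : 1 ≤ n) (u v : Ω → Fin n → ℝ)
    (hum : ∀ i, Measurable fun ω => u ω i) (hvm : ∀ i, Measurable fun ω => v ω i)
    (Su Sv : Matrix (Fin n) (Fin n) ℝ) (hSu : Su.PosSemidef) (hSv : Sv.PosSemidef)
    (hu : IsCenteredGaussianVector P (fun ω i => u ω i) Su)
    (hv : IsCenteredGaussianVector P (fun ω i => v ω i) Sv)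
    (hdiag : ∀ i, Su i i = Sv i i) (hle : ∀ i j, Sv i j ≤ Su i j) :
    ∀ y : ℝ, P {ω | ∀ i, v ω i ≤ y} ≤ P {ω | ∀ i, u ω i ≤ y} := by
  intro y
  obtain ⟨A, hA⟩ := slep_fac hSu
  obtain ⟨B, hB⟩ := slep_fac hSv
  let a : Fin n → (Fin n ⊕ Fin n) → ℝ := fun i => Sum.elim (fun k => A k i) (fun _ => 0)
  let b : Fin n → (Fin n ⊕ Fin n) → ℝ := fun i => Sum.elim (fun _ => 0) (fun k => B k i)
  have ha : ∀ i j, ∑ k, a i k * a j k = Su i j := by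
    intro i j; simp [a, hA, Matrix.mul_apply]
  have hb : ∀ i j, ∑ k, b i k * b j k = Sv i j := by
    intro i j; simp [b, hB, Matrix.mul_apply]
  have hab : ∀ i j, ∑ k, a i k * b j k = 0 := by
    intro i j; simp [a, b]
  clear_value a b
  have hum' : Measurable u := measurable_pi_iff.2 hum
  have hvm' : Measurable v := measurable_pi_iff.2 hvm
  have lu := slep_law P u hum' Su hu a ha
  have lv := slep_law P v hvm' Sv hv b hb
  have pu := Measure.isProbabilityMeasure_map (μ := P) hum'.aemeasurable
  have pv := Measure.isProbabilityMeasure_map (μ := P) hvm'.aemeasurable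
  have hms : MeasurableSet {x : Fin n → ℝ | ∀ i, x i ≤ y} := by
    rw [Set.ofPred_forall]
    exact MeasurableSet.iInter fun i => measurableSet_le (measurable_pi_apply i) measurable_const
  have key : (P.map v).real {x | ∀ i, x i ≤ y} ≤ (P.map u).real {x | ∀ i, x i ≤ y} := by
    refine le_of_tendsto_of_tendsto' (slep_lim (P.map v) y) (slep_lim (P.map u) y) fun N => ?_
    have hc : Continuous (fun x : Fin n → ℝ => ∏ i, Real.sigmoid ((N : ℝ) ^ 2 * (y - x i) + N)) :=
      continuous_finsetProd _ fun i _ => continuous_sigmoid.comp (by fun_prop)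
    rw [lu, lv, integral_map (Measurable.aemeasurable (by fun_prop)) hc.aestronglyMeasurable,
      integral_map (Measurable.aemeasurable (by fun_prop)) hc.aestronglyMeasurable]
    exact slep_sig y _ _ (sq_nonneg _) Su Sv hdiag hle a b ha hb hab
  have h2 := (ENNReal.toReal_le_toReal (measure_ne_top _ _) (measure_ne_top _ _)).1 key
  rw [Measure.map_apply hum' hms, Measure.map_apply hvm' hms] at h2
  exact h2
end
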